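/- Let S be a solution concept that permits bracketing and satisfies strategic invariance, distribution-monotonicity, and anonymity. Then S satisfies expectation-monotonicity. -/

import Mathlib

open Filter Topology MeasureTheory

noncomputable section

namespace Paper

/-! ## Lotteries as finitely supported probability mass functions on ℝ -/

open Classical in
/-- The point mass at `a`. -/
def delta {α : Type*} (a : α) : α → ℝ := fun b => if b = a then 1 else 0

/-- `f` is (the p.m.f. of) a finitely supported lottery. -/
def IsFinLottery (f : ℝ → ℝ) : Prop :=
  (∀ x, 0 ≤ f x) ∧ (Function.support f).Finite ∧ ∑ᶠ x, f x = 1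

/-- The CDF of a mass function. -/
def cdfOf (f : ℝ → ℝ) (t : ℝ) : ℝ := ∑ᶠ x, if x ≤ t then f x else 0

/-- Convolution: the distribution of the sum of independent draws. -/
def conv (f g : ℝ → ℝ) : ℝ → ℝ := fun z => ∑ᶠ x, f x * g (z - x)

/-- Expectation of a finitely supported lottery. -/
def expOf (f : ℝ → ℝ) : ℝ := ∑ᶠ x, x * f x

/-- Weak first-order stochastic dominance of `f` over `g`. -/
def FOSDgeF (f g : ℝ → ℝ) : Prop := ∀ t, cdfOf f t ≤ cdfOf g t

/-- Strict first-order stochastic dominance of `f` over `g`. -/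
def FOSDgtF (f g : ℝ → ℝ) : Prop := FOSDgeF f g ∧ f ≠ g

/-- Finitely supported lotteries with rational-valued CDF (`Δ_ℚ`). -/
def IsDeltaQ (f : ℝ → ℝ) : Prop := IsFinLottery f ∧ ∀ t, ∃ q : ℚ, cdfOf f t = (q : ℝ)

/-- Monotone additive statistic on all finitely supported lotteries. -/
def MAS (Φ : (ℝ → ℝ) → ℝ) : Prop :=
  (∀ c : ℝ, Φ (delta c) = c) ∧
  (∀ f g, IsFinLottery f → IsFinLottery g → Φ (conv f g) = Φ f + Φ g) ∧
  (∀ f g, IsFinLottery f → IsFinLottery g → FOSDgeF f g → Φ g ≤ Φ f)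

/-- Monotone additive statistic on `Δ_ℚ`. -/
def MASQ (Φ : (ℝ → ℝ) → ℝ) : Prop :=
  (∀ c : ℝ, Φ (delta c) = c) ∧
  (∀ f g, IsDeltaQ f → IsDeltaQ g → Φ (conv f g) = Φ f + Φ g) ∧
  (∀ f g, IsDeltaQ f → IsDeltaQ g → FOSDgeF f g → Φ g ≤ Φ f)

/-- The statistic `K_a` for `a` in the extended real line. -/
def Kstat (a : EReal) (f : ℝ → ℝ) : ℝ :=
  if a = ⊤ then sSup (Function.support f)
  else if a = ⊥ then sInf (Function.support f)
  else if a = 0 then expOf f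
  else (a.toReal)⁻¹ * Real.log (∑ᶠ x, Real.exp (a.toReal * x) * f x)

/-- `K_a` for real `a`. -/
def Kreal (a : ℝ) : (ℝ → ℝ) → ℝ := Kstat (a : EReal)

/-- The statistic `Φ[X] = ∫ K_a[X] dμ(a)`. -/
def PhiInt (μ : Measure EReal) (f : ℝ → ℝ) : ℝ := ∫ a, Kstat a f ∂μ

/-! ## Finite normal-form games -/

structure Game (N : ℕ) where
  A : Fin N → Type
  fintypeA : ∀ i, Fintype (A i)
  nonemptyA : ∀ i, Nonempty (A i)
  u : ((i : Fin N) → A i) → Fin N → ℝ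

instance {N : ℕ} (G : Game N) (i : Fin N) : Fintype (G.A i) := G.fintypeA i
instance {N : ℕ} (G : Game N) (i : Fin N) : Nonempty (G.A i) := G.nonemptyA i

/-- A (mixed strategy) profile: a real-valued function on each action set. -/
abbrev Profile {N : ℕ} (G : Game N) := (i : Fin N) → G.A i → ℝ

/-- `p` is a mixed strategy profile. -/
def IsMixed {N : ℕ} (G : Game N) (p : Profile G) : Prop :=
  ∀ i, (∀ ai, 0 ≤ p i ai) ∧ ∑ ai, p i ai = 1

/-- Probability of the full action profile `a` under independent mixing `p`. -/
def weight {N : ℕ} (G : Game N) (p : Profile G) (a : (i : Fin N) → G.A i) : ℝ :=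
  ∏ j, p j (a j)

/-- The p.m.f. of player `i`'s payoff lottery `u_i(a_i, p_{-i})`. -/
def payMass {N : ℕ} (G : Game N) (p : Profile G) (i : Fin N) (ai : G.A i) : ℝ → ℝ :=
  fun t => ∑ a : (j : Fin N) → G.A j,
    if G.u a i = t then weight G (Function.update p i (delta ai)) a else 0

/-- Expected payoff `E[u_i(a_i, p_{-i})]`. -/
def expPay {N : ℕ} (G : Game N) (p : Profile G) (i : Fin N) (ai : G.A i) : ℝ :=
  ∑ a : (j : Fin N) → G.A j, weight G (Function.update p i (delta ai)) a * G.u a i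

/-- Expected value of `f` applied to player `i`'s payoff lottery. -/
def expPayOf {N : ℕ} (G : Game N) (p : Profile G) (i : Fin N) (ai : G.A i) (f : ℝ → ℝ) : ℝ :=
  ∑ a : (j : Fin N) → G.A j, weight G (Function.update p i (delta ai)) a * f (G.u a i)

/-- Minimum over `a_{-i}` of `u_i(a_i, a_{-i})`. -/
def minPay {N : ℕ} (G : Game N) (i : Fin N) (ai : G.A i) : ℝ :=
  ⨅ a : (j : Fin N) → G.A j, G.u (Function.update a i ai) i

/-- Maximum over `a_{-i}` of `u_i(a_i, a_{-i})`. -/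
def maxPay {N : ℕ} (G : Game N) (i : Fin N) (ai : G.A i) : ℝ :=
  ⨆ a : (j : Fin N) → G.A j, G.u (Function.update a i ai) i

/-- `a_i` is strictly dominated (by some `b_i`). -/
def StrictlyDominated {N : ℕ} (G : Game N) (i : Fin N) (ai : G.A i) : Prop :=
  ∃ bi : G.A i, ∀ a : (j : Fin N) → G.A j,
    G.u (Function.update a i ai) i < G.u (Function.update a i bi) i

/-! ## Solution concepts and axioms -/

abbrev SolCon (N : ℕ) := (G : Game N) → Set (Profile G)

/-- A solution concept assigns to each game a nonempty set of mixed strategy profiles. -/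
def IsSolutionConcept {N : ℕ} (S : SolCon N) : Prop :=
  ∀ G, (S G).Nonempty ∧ ∀ p ∈ S G, IsMixed G p

/-- The composite game `G ⊗ H`. -/
def Game.comp {N : ℕ} (G H : Game N) : Game N where
  A := fun i => G.A i × H.A i
  fintypeA := fun i => inferInstance
  nonemptyA := fun i => inferInstance
  u := fun c i => G.u (fun j => (c j).1) i + H.u (fun j => (c j).2) i

/-- The product profile `p × q`. -/
def prodProfile {N : ℕ} {G H : Game N} (p : Profile G) (q : Profile H) :
    Profile (G.comp H) := fun i ab => p i ab.1 * q i ab.2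

def Bracketing {N : ℕ} (S : SolCon N) : Prop :=
  ∀ (G H : Game N) (p : Profile G) (q : Profile H),
    p ∈ S G → q ∈ S H → prodProfile p q ∈ S (G.comp H)

/-- The permuted game `G_π`. -/
def Game.permute {N : ℕ} (G : Game N) (π : Equiv.Perm (Fin N)) : Game N where
  A := fun i => G.A (π i)
  fintypeA := fun i => G.fintypeA (π i)
  nonemptyA := fun i => G.nonemptyA (π i)
  u := fun b i =>
    G.u (fun j => cast (congrArg G.A (π.apply_symm_apply j)) (b (π.symm j))) (π i)

def Anonymity {N : ℕ} (S : SolCon N) : Prop :=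
  ∀ (π : Equiv.Perm (Fin N)) (G : Game N) (p : Profile G),
    p ∈ S G → (fun i => p (π i)) ∈ S (G.permute π)

def ExpectationMonotone {N : ℕ} (S : SolCon N) : Prop :=
  ∀ G, ∀ p ∈ S G, ∀ i, ∀ ai bi : G.A i,
    expPay G p i bi < expPay G p i ai → p i bi ≤ p i ai

def ExpectationNeutral {N : ℕ} (S : SolCon N) : Prop :=
  ∀ G, ∀ p ∈ S G, ∀ i, ∀ ai bi : G.A i,
    expPay G p i ai = expPay G p i bi → p i ai = p i bi

def DistributionMonotone {N : ℕ} (S : SolCon N) : Prop :=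
  ∀ G, ∀ p ∈ S G, ∀ i, ∀ ai bi : G.A i,
    FOSDgtF (payMass G p i ai) (payMass G p i bi) → p i bi ≤ p i ai

def Interiority {N : ℕ} (S : SolCon N) : Prop :=
  ∀ G, ∀ p ∈ S G, ∀ i, ∀ ai : G.A i, 0 < p i ai

/-- The game with payoffs rescaled by `α`. -/
def Game.scale {N : ℕ} (G : Game N) (α : ℝ) : Game N :=
  { G with u := fun a i => α * G.u a i }

def ScaleInvariant {N : ℕ} (S : SolCon N) : Prop :=
  ∀ G : Game N, ∀ p ∈ S G,
    (∀ i, ∀ ai : G.A i, p i ai = ((Fintype.card (G.A i) : ℝ))⁻¹) →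
    ∀ α ∈ Set.Ioo (0 : ℝ) 1, p ∈ S (G.scale α)

def StratInvariant {N : ℕ} (S : SolCon N) : Prop :=
  ∀ (G : Game N) (u' : ((i : Fin N) → G.A i) → Fin N → ℝ),
    (∀ i, ∃ w : ((j : Fin N) → G.A j) → ℝ,
      (∀ a, ∀ bi : G.A i, w (Function.update a i bi) = w a) ∧
      (∀ a, u' a i = G.u a i + w a)) →
    S G = S { G with u := u' }

/-! ## Equilibrium notions -/

def IsNash {N : ℕ} (G : Game N) (p : Profile G) : Prop :=
  ∀ i, ∀ ai : G.A i, 0 < p i ai → ∀ bi : G.A i, expPay G p i bi ≤ expPay G p i ai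

def IsLQRE {N : ℕ} (lam : ℝ) (G : Game N) (p : Profile G) : Prop :=
  ∀ i, ∀ ai : G.A i,
    p i ai = Real.exp (lam * expPay G p i ai) / ∑ bi, Real.exp (lam * expPay G p i bi)

def IsNashPhi {N : ℕ} (Φ : (ℝ → ℝ) → ℝ) (G : Game N) (p : Profile G) : Prop :=
  ∀ i, ∀ ai : G.A i, 0 < p i ai → ∀ bi : G.A i,
    Φ (payMass G p i bi) ≤ Φ (payMass G p i ai)

def IsLQREPhi {N : ℕ} (Φ : (ℝ → ℝ) → ℝ) (lam : ℝ) (G : Game N) (p : Profile G) : Prop :=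
  ∀ i, ∀ ai : G.A i,
    p i ai = Real.exp (lam * Φ (payMass G p i ai)) /
      ∑ bi, Real.exp (lam * Φ (payMass G p i bi))

def IsFOSDNash {N : ℕ} (G : Game N) (p : Profile G) : Prop :=
  ∀ i, ∀ ai : G.A i,
    (∃ bi : G.A i, FOSDgtF (payMass G p i bi) (payMass G p i ai)) → p i ai = 0

def IsFOSDQRE {N : ℕ} (G : Game N) (p : Profile G) : Prop :=
  (∀ i, ∀ ai : G.A i, 0 < p i ai) ∧
  ∀ i, ∀ ai bi : G.A i,
    FOSDgeF (payMass G p i ai) (payMass G p i bi) → p i bi ≤ p i ai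

def IsMinMaxMean {N : ℕ} (l1 l2 l3 : ℝ) (G : Game N) (p : Profile G) : Prop :=
  ∀ i, ∀ ai : G.A i,
    p i ai = Real.exp (l1 * minPay G i ai + l2 * expPay G p i ai + l3 * maxPay G i ai) /
      ∑ bi, Real.exp (l1 * minPay G i bi + l2 * expPay G p i bi + l3 * maxPay G i bi)

def CompatibleEU {N : ℕ} (S : SolCon N) : Prop :=
  ∃ f : ℝ → ℝ, StrictMono f ∧ Continuous f ∧
    ∀ G, ∀ p ∈ S G, ∀ i, ∀ ai bi : G.A i,
      expPayOf G p i bi f < expPayOf G p i ai f → p i bi ≤ p i ai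

/-! ## Lotteries as compactly supported probability measures on ℝ -/

/-- Convolution of measures: distribution of the sum of independent draws. -/
def mconv (μ ν : Measure ℝ) : Measure ℝ := (μ.prod ν).map (fun z : ℝ × ℝ => z.1 + z.2)

/-- `npow μ m` is the `m`-fold convolution `μ^m`. -/
def npow (μ : Measure ℝ) : ℕ → Measure ℝ
  | 0 => Measure.dirac 0
  | n + 1 => mconv (npow μ n) μ

/-- The distribution of `β` times a draw from `μ`. -/
def mscale (β : ℝ) (μ : Measure ℝ) : Measure ℝ := μ.map (fun x => β * x)

/-- `μ` is compactly supported. -/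
def CompSupp (μ : Measure ℝ) : Prop := ∃ a b : ℝ, μ (Set.Icc a b)ᶜ = 0

/-- The minimum of the support of `μ`. -/
def minSupp (μ : Measure ℝ) : ℝ := sSup {x : ℝ | μ (Set.Iio x) = 0}

/-- The maximum of the support of `μ`. -/
def maxSupp (μ : Measure ℝ) : ℝ := sInf {x : ℝ | μ (Set.Ioi x) = 0}

/-- Weak first-order stochastic dominance of `μ` over `ν`. -/
def FOSDgeM (μ ν : Measure ℝ) : Prop := ∀ t, μ (Set.Iic t) ≤ ν (Set.Iic t)

/-- Strict first-order stochastic dominance of `μ` over `ν`. -/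
def FOSDgtM (μ ν : Measure ℝ) : Prop := FOSDgeM μ ν ∧ μ ≠ ν

/-- Monotone additive statistic on compactly supported lotteries (as measures). -/
def MASm (Φ : Measure ℝ → ℝ) : Prop :=
  (∀ c : ℝ, Φ (Measure.dirac c) = c) ∧
  (∀ μ ν : Measure ℝ, IsProbabilityMeasure μ → IsProbabilityMeasure ν →
    CompSupp μ → CompSupp ν → Φ (mconv μ ν) = Φ μ + Φ ν) ∧
  (∀ μ ν : Measure ℝ, IsProbabilityMeasure μ → IsProbabilityMeasure ν →
    CompSupp μ → CompSupp ν → FOSDgeM μ ν → Φ ν ≤ Φ μ)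

/-! ## Two-player games, unbundled -/

/-- `p` is a probability distribution on the finite type `α`. -/
def IsDist {α : Type*} [Fintype α] (p : α → ℝ) : Prop :=
  (∀ a, 0 ≤ p a) ∧ ∑ a, p a = 1

/-- Payoff lottery of player 1 playing `a` against the mixed strategy `q`. -/
def mass1 {α β : Type*} [Fintype β] (u : α → β → ℝ) (q : β → ℝ) (a : α) : ℝ → ℝ :=
  fun t => ∑ b, if u a b = t then q b else 0

/-- Payoff lottery of player 2 playing `b` against the mixed strategy `p`. -/
def mass2 {α β : Type*} [Fintype α] (u : α → β → ℝ) (p : α → ℝ) (b : β) : ℝ → ℝ :=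
  fun t => ∑ a, if u a b = t then p a else 0

/-- The distribution of a random variable on the uniform space `{1,…,m}`. -/
def distOf {m : ℕ} (X : Fin m → ℝ) : ℝ → ℝ :=
  fun t => (∑ ω : Fin m, if X ω = t then (1 : ℝ) else 0) / m


/-- A finite probability vector with atoms at most `ε` carries a `[0,1]`-valued function whose
distribution function is within `ε` of that of the uniform distribution. -/
lemma exists_approx_uniform {K : Type*} [Fintype K] (μ : K → ℝ) (hμ0 : ∀ x, 0 ≤ μ x)
    (hμ1 : ∑ x, μ x = 1) {ε : ℝ} (hε : ∀ x, μ x ≤ ε) (hε0 : 0 < ε) :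
    ∃ V : K → ℝ, (∀ x, 0 ≤ V x ∧ V x ≤ 1) ∧
      (∀ t, 0 ≤ t → (∑ x, if V x ≤ t then μ x else 0) ≤ t) ∧
      (∀ t, t ≤ 1 → t - ε ≤ ∑ x, if V x ≤ t then μ x else 0) := by
  classical
  have key : ∀ s : Finset K, ∃ V : K → ℝ, (∀ x ∈ s, 0 ≤ V x ∧ V x ≤ ∑ y ∈ s, μ y) ∧
      (∀ t, 0 ≤ t → (∑ x ∈ s, if V x ≤ t then μ x else 0) ≤ t) ∧
      (∀ t, t ≤ ∑ y ∈ s, μ y → t - ε ≤ ∑ x ∈ s, if V x ≤ t then μ x else 0) := by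
    intro s
    induction s using Finset.induction_on with
    | empty =>
      refine ⟨fun _ => 0, by simp, by simp, ?_⟩
      intro t ht
      simp only [Finset.sum_empty] at ht ⊢
      linarith
    | insert x s hx ih =>
      obtain ⟨V, hV, hup, hlo⟩ := ih
      have hs0 : 0 ≤ ∑ y ∈ s, μ y := Finset.sum_nonneg fun y _ => hμ0 y
      have hsplit : ∀ t, (∑ y ∈ insert x s,
          if Function.update V x (μ x + ∑ y ∈ s, μ y) y ≤ t then μ y else 0) =
          (if μ x + ∑ y ∈ s, μ y ≤ t then μ x else 0) +
            ∑ y ∈ s, if V y ≤ t then μ y else 0 := by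
        intro t
        rw [Finset.sum_insert hx, Function.update_self]
        congr 1
        refine Finset.sum_congr rfl fun y hy => ?_
        rw [Function.update_of_ne (by rintro rfl; exact hx hy)]
      have hle : ∀ t, (∑ y ∈ s, if V y ≤ t then μ y else 0) ≤ ∑ y ∈ s, μ y := by
        intro t
        refine Finset.sum_le_sum fun y _ => ?_
        split_ifs
        · exact le_rfl
        · exact hμ0 y
      refine ⟨Function.update V x (μ x + ∑ y ∈ s, μ y), ?_, ?_, ?_⟩
      · intro y hy
        rw [Finset.sum_insert hx]
        have := hμ0 x
        rcases eq_or_ne y x with rfl | hne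
        · rw [Function.update_self]
          exact ⟨by linarith, le_rfl⟩
        · rw [Function.update_of_ne hne]
          have := hV y (Finset.mem_of_mem_insert_of_ne hy hne)
          exact ⟨this.1, by linarith [this.2]⟩
      · intro t ht
        rw [hsplit]
        split_ifs with h
        · linarith [hle t]
        · linarith [hup t ht]
      · intro t ht
        rw [hsplit]
        rw [Finset.sum_insert hx] at ht
        have hx0 : 0 ≤ if μ x + ∑ y ∈ s, μ y ≤ t then μ x else 0 := by
          split_ifs
          · exact hμ0 x
          · exact le_rfl
        rcases le_or_gt t (∑ y ∈ s, μ y) with h | h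
        · linarith [hlo t h]
        · have : (∑ y ∈ s, if V y ≤ t then μ y else 0) = ∑ y ∈ s, μ y :=
            Finset.sum_congr rfl fun y hy => if_pos ((hV y hy).2.trans h.le)
          linarith [hε x]
  obtain ⟨V, h1, h2, h3⟩ := key Finset.univ
  rw [hμ1] at h3
  exact ⟨V, fun x => by simpa [hμ1] using h1 x (Finset.mem_univ x), h2, h3⟩

/-- A variable `Z` of positive mean strictly improves a suitable correlated noise `W` in the sense
of first-order stochastic dominance, provided a sufficiently diffuse independent variable is
available. -/
lemma exists_correlated_noise {Ω : Type*} [Fintype Ω] (P : Ω → ℝ) (hP0 : ∀ ω, 0 ≤ P ω)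
    (hP1 : ∑ ω, P ω = 1) (Z : Ω → ℝ) (hZ : 0 < ∑ ω, P ω * Z ω) :
    ∃ ε : ℝ, 0 < ε ∧ ∀ {K : Type} [Fintype K] (μ : K → ℝ), (∀ x, 0 ≤ μ x) → ∑ x, μ x = 1 →
      (∀ x, μ x ≤ ε) → ∃ W : ℝ → K → ℝ,
        (∀ t, ∑ ω, P ω * (∑ x, if Z ω + W (Z ω) x ≤ t then μ x else 0) ≤
          ∑ ω, P ω * (∑ x, if W (Z ω) x ≤ t then μ x else 0)) ∧
        ∃ t, ∑ ω, P ω * (∑ x, if Z ω + W (Z ω) x ≤ t then μ x else 0) <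
          ∑ ω, P ω * (∑ x, if W (Z ω) x ≤ t then μ x else 0) := by
  obtain ⟨b, hb0, hb⟩ : ∃ b : ℝ, 0 < b ∧ ∀ ω, |Z ω| ≤ b :=
    ⟨∑ ω, |Z ω| + 1, by positivity, fun ω => by
      have := Finset.single_le_sum (f := fun ω => |Z ω|) (fun _ _ => abs_nonneg _)
        (Finset.mem_univ ω)
      linarith⟩
  set p := ∑ ω, P ω * max (Z ω) 0 with hp
  set n := ∑ ω, P ω * max (-Z ω) 0 with hn
  have hpn : ∑ ω, P ω * Z ω = p - n := by
    rw [hp, hn, ← Finset.sum_sub_distrib]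
    refine Finset.sum_congr rfl fun ω _ => ?_
    rw [← mul_sub, max_comm (-Z ω), ← max_zero_sub_max_neg_zero_eq_self (Z ω)]
    rcases le_total (Z ω) 0 with h | h <;> simp [h]
  rw [hpn] at hZ
  have hn0 : 0 ≤ n := Finset.sum_nonneg fun ω _ => mul_nonneg (hP0 ω) (le_max_right _ _)
  obtain ⟨M, hM, hMp⟩ : ∃ M : ℝ, 2 * b < M ∧ n / (M - 2 * b) < p / M := by
    refine ⟨p * (2 * b) / (p - n) + 2 * b + 1, ?_, ?_⟩
    · have : 0 ≤ p * (2 * b) / (p - n) := by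
        apply div_nonneg _ hZ.le
        apply mul_nonneg <;> linarith
      linarith
    · have h0 : 0 ≤ p * (2 * b) / (p - n) := by
        apply div_nonneg _ hZ.le
        apply mul_nonneg <;> linarith
      have h1 : p * (2 * b) / (p - n) * (p - n) = p * (2 * b) := div_mul_cancel₀ _ hZ.ne'
      rw [div_lt_div_iff₀ (by linarith) (by linarith)]
      nlinarith
  have hM0 : 0 < M := by linarith
  have hMb : 0 < M - 2 * b := by linarith
  refine ⟨(p / M - n / (M - 2 * b)) / 2, by linarith, ?_⟩
  intro K _ μ hμ0 hμ1 hε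
  set ε := (p / M - n / (M - 2 * b)) / 2 with hεdef
  have hε0 : 0 < ε := by linarith
  obtain ⟨V, hV, hup, hlo⟩ := exists_approx_uniform μ hμ0 hμ1 hε hε0
  set F : ℝ → ℝ := fun s => ∑ x, if V x ≤ s then μ x else 0 with hF
  have hmono : Monotone F := by
    intro s t hst
    refine Finset.sum_le_sum fun x _ => ?_
    split_ifs with h1 h2
    · exact le_rfl
    · exact absurd (h1.trans hst) h2
    · exact hμ0 x
    · exact le_rfl
  have hneg : ∀ s, s < 0 → F s = 0 := fun s hs =>
    Finset.sum_eq_zero fun x _ => if_neg (by linarith [(hV x).1])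
  have hone : ∀ s, 1 ≤ s → F s = 1 := fun s hs => by
    rw [← hμ1]
    exact Finset.sum_congr rfl fun x _ => if_pos (by linarith [(hV x).2])
  have hle1 : ∀ s, F s ≤ 1 := fun s => (hmono (le_max_left s 1)).trans (hone _ (le_max_right _ _)).le
  have hup : ∀ s, 0 ≤ s → F s ≤ s := hup
  have hlo : ∀ s, s ≤ 1 → s - ε ≤ F s := hlo
  set W : ℝ → K → ℝ := fun z x => if 0 ≤ z then M * V x else 2 * b + (M - 2 * b) * V x with hW
  have hWF : ∀ z t, (∑ x, if W z x ≤ t then μ x else 0) =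
      if 0 ≤ z then F (t / M) else F ((t - 2 * b) / (M - 2 * b)) := by
    intro z t
    split_ifs with hz
    · refine Finset.sum_congr rfl fun x _ => ?_
      simp only [hW, if_pos hz, le_div_iff₀ hM0, mul_comm]
    · refine Finset.sum_congr rfl fun x _ => ?_
      simp only [hW, if_neg hz, le_div_iff₀ hMb]
      congr 1
      rw [mul_comm (V x), eq_iff_iff, le_sub_iff_add_le']
  have hshift : ∀ z t, (∑ x, if z + W z x ≤ t then μ x else 0) =
      ∑ x, if W z x ≤ t - z then μ x else 0 := by
    intro z t
    simp only [le_sub_iff_add_le']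
  have outer : ∀ t, (t < b ∨ M ≤ t) → ∀ z, |z| ≤ b →
      (∑ x, if z + W z x ≤ t then μ x else 0) ≤ ∑ x, if W z x ≤ t then μ x else 0 := by
    intro t ht z hzb
    rw [hshift, hWF, hWF]
    obtain ⟨hz1, hz2⟩ := abs_le.1 hzb
    split_ifs with hz
    · exact hmono (by gcongr; linarith)
    · rcases ht with ht | ht
      · rw [hneg ((t - z - 2 * b) / (M - 2 * b)) (div_neg_of_neg_of_pos (by linarith) hMb)]
        exact Finset.sum_nonneg fun x _ => by
          split_ifs
          · exact hμ0 x
          · exact le_rfl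
      · rw [hone ((t - 2 * b) / (M - 2 * b)) (by rw [le_div_iff₀ hMb]; linarith)]
        exact hle1 _
  have inner : ∀ t, b ≤ t → t < M → ∀ z, |z| ≤ b →
      (max z 0 / M - max (-z) 0 / (M - 2 * b) - ε) +
      (∑ x, if z + W z x ≤ t then μ x else 0) ≤ ∑ x, if W z x ≤ t then μ x else 0 := by
    intro t ht1 ht2 z hzb
    rw [hshift, hWF, hWF]
    obtain ⟨hz1, hz2⟩ := abs_le.1 hzb
    split_ifs with hz
    · rw [max_eq_left hz, max_eq_right (by linarith : -z ≤ 0)]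
      have h1 := hlo (t / M) (by rw [div_le_one hM0]; exact ht2.le)
      have h2 := hup ((t - z) / M) (div_nonneg (by linarith) hM0.le)
      rw [sub_div] at h2
      rw [zero_div, sub_div]
      linarith
    · push Not at hz
      rw [max_eq_right hz.le, max_eq_left (by linarith : 0 ≤ -z), zero_div, neg_div]
      have hz' : z / (M - 2 * b) ≤ 0 := div_nonpos_of_nonpos_of_nonneg hz.le hMb.le
      rcases lt_or_ge ((t - z - 2 * b) / (M - 2 * b)) 0 with h | h
      · rw [hneg _ h]
        have : 0 ≤ F ((t - 2 * b) / (M - 2 * b)) := Finset.sum_nonneg fun x _ => by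
          split_ifs
          · exact hμ0 x
          · exact le_rfl
        linarith
      · have h1 := hlo ((t - 2 * b) / (M - 2 * b)) (by rw [div_le_one hMb]; linarith)
        have h2 := hup _ h
        have h3 : (t - z - 2 * b) / (M - 2 * b) =
          (t - 2 * b) / (M - 2 * b) - z / (M - 2 * b) := by rw [← sub_div]; congr 1; ring
        linarith
  have middle : ∀ t, b ≤ t → t < M →
      ∑ ω, P ω * (∑ x, if Z ω + W (Z ω) x ≤ t then μ x else 0) <
        ∑ ω, P ω * (∑ x, if W (Z ω) x ≤ t then μ x else 0) := by
    intro t ht1 ht2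
    have h := Finset.sum_le_sum fun ω (_ : ω ∈ Finset.univ) =>
      mul_le_mul_of_nonneg_left (inner t ht1 ht2 (Z ω) (hb ω)) (hP0 ω)
    have h' : ∑ ω, P ω * (max (Z ω) 0 / M - max (-Z ω) 0 / (M - 2 * b) - ε) =
        p / M - n / (M - 2 * b) - ε := by
      simp only [mul_sub, Finset.sum_sub_distrib, ← mul_div_assoc, ← Finset.sum_div,
        ← Finset.sum_mul, hP1, one_mul, hp, hn]
    simp only [mul_add, Finset.sum_add_distrib] at h
    rw [h'] at h
    linarith
  refine ⟨W, fun t => ?_, b, middle b le_rfl (by linarith)⟩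
  by_cases ht : b ≤ t ∧ t < M
  · exact (middle t ht.1 ht.2).le
  · refine Finset.sum_le_sum fun ω _ => mul_le_mul_of_nonneg_left (outer t ?_ _ (hb ω)) (hP0 ω)
    by_contra! h
    exact ht h

section Games

variable {N : ℕ}

lemma weight_nonneg {G : Game N} {p : Profile G} (hp : IsMixed G p)
    (a : (i : Fin N) → G.A i) : 0 ≤ weight G p a :=
  Finset.prod_nonneg fun j _ => (hp j).1 _

lemma sum_weight (G : Game N) (p : Profile G) :
    ∑ a, weight G p a = ∏ i, ∑ x, p i x := by
  classical
  simp only [weight, Finset.prod_univ_sum, Fintype.piFinset_univ]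

lemma sum_weight_eq_one {G : Game N} {p : Profile G} (hp : IsMixed G p) :
    ∑ a, weight G p a = 1 := by
  rw [sum_weight]
  exact Finset.prod_eq_one fun i _ => (hp i).2

/-- The marginal of the product distribution on the actions of player `j`. -/
lemma sum_weight_mul_apply {G : Game N} {p : Profile G} (hp : IsMixed G p) (j : Fin N)
    (f : G.A j → ℝ) : ∑ a, weight G p a * f (a j) = ∑ x, p j x * f x := by
  classical
  have h : ∀ a, weight G p a * f (a j) =
      weight G (Function.update p j fun x => p j x * f x) a := by
    intro a
    unfold weight
    rw [Fintype.prod_eq_mul_prod_compl j, Fintype.prod_eq_mul_prod_compl j,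
      Function.update_self, mul_right_comm]
    congr 1
    refine Finset.prod_congr rfl fun k hk => ?_
    rw [Function.update_of_ne (by simpa using hk)]
  simp only [h, sum_weight]
  rw [Fintype.prod_eq_mul_prod_compl j, Function.update_self, Finset.prod_eq_one, mul_one]
  intro k hk
  rw [Function.update_of_ne (by simpa using hk)]
  exact (hp k).2

/-- Fixing the action of player `i` amounts to resampling it from `p i` and overwriting it. -/
lemma sum_weight_update_delta {G : Game N} {p : Profile G} (hp : IsMixed G p) (i : Fin N)
    (x : G.A i) (F : ((j : Fin N) → G.A j) → ℝ) :
    ∑ a, weight G (Function.update p i (delta x)) a * F a =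
      ∑ a, weight G p a * F (Function.update a i x) := by
  classical
  rw [← (Equiv.piSplitAt i G.A).symm.sum_comp, ← (Equiv.piSplitAt i G.A).symm.sum_comp,
    Fintype.sum_prod_type_right, Fintype.sum_prod_type_right]
  refine Finset.sum_congr rfl fun r _ => ?_
  have hw : ∀ (q : Profile G) (y : G.A i), weight G q ((Equiv.piSplitAt i G.A).symm (y, r)) =
      q i y * ∏ j : {j // j ≠ i}, q j (r j) := by
    intro q y
    unfold weight
    rw [Fintype.prod_eq_mul_prod_subtype_ne _ i]
    congr 1
    · simp
    · refine Finset.prod_congr rfl fun j _ => ?_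
      simp [j.2]
  have hu : ∀ y : G.A i, Function.update ((Equiv.piSplitAt i G.A).symm (y, r)) i x =
      (Equiv.piSplitAt i G.A).symm (x, r) := by
    intro y
    funext j
    rcases eq_or_ne j i with rfl | hj
    · simp
    · simp [hj]
  simp only [hw, hu, Function.update_self]
  have : ∏ j : {j // j ≠ i}, Function.update p i (delta x) j (r j) =
      ∏ j : {j // j ≠ i}, p j (r j) :=
    Finset.prod_congr rfl fun j _ => by rw [Function.update_of_ne j.2]
  rw [this, Finset.sum_eq_single x]
  · simp only [delta, if_true, mul_assoc, ← Finset.sum_mul, (hp i).2]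
  · intro y _ hy
    simp [delta, hy]
  · simp

lemma cdfOf_payMass {G : Game N} {p : Profile G} (hp : IsMixed G p) (i : Fin N) (x : G.A i)
    (t : ℝ) : cdfOf (payMass G p i x) t =
      ∑ a, if G.u (Function.update a i x) i ≤ t then weight G p a else 0 := by
  classical
  have h := sum_weight_update_delta hp i x fun a => if G.u a i ≤ t then 1 else 0
  simp only [mul_ite, mul_one, mul_zero] at h
  rw [← h]
  unfold cdfOf payMass
  rw [finsum_eq_sum_of_support_subset (s := Finset.univ.image fun a => G.u a i)]
  · have : ∀ y : ℝ, (if y ≤ t then ∑ a, if G.u a i = y then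
        weight G (Function.update p i (delta x)) a else 0 else 0) =
        ∑ a, if G.u a i = y then (if G.u a i ≤ t then
          weight G (Function.update p i (delta x)) a else 0) else 0 := by
      intro y
      split_ifs with hy
      · refine Finset.sum_congr rfl fun a _ => ?_
        split_ifs with h1 h2 <;> first | rfl | (exfalso; apply h2; rw [h1]; exact hy)
      · symm
        refine Finset.sum_eq_zero fun a _ => ?_
        split_ifs with h1 h2 <;> first | rfl | (exfalso; apply hy; rw [← h1]; exact h2)
    simp only [this]
    rw [Finset.sum_comm]
    refine Finset.sum_congr rfl fun a _ => ?_
    rw [Finset.sum_ite_eq, if_pos (Finset.mem_image_of_mem _ (Finset.mem_univ a))]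
  · intro y hy
    by_contra hny
    apply hy
    simp only
    rw [Finset.sum_eq_zero, ite_self]
    intro a _
    refine if_neg fun hay => hny ?_
    rw [← hay]
    simp

/-- Distribution-monotonicity after adding a term `W` that does not depend on the action of
player `i`. -/
lemma le_of_noise {S : SolCon N} (hS : IsSolutionConcept S) (hSI : StratInvariant S)
    (hDM : DistributionMonotone S) {G : Game N} {p : Profile G} (hp : p ∈ S G) (i : Fin N)
    (x y : G.A i) (W : ((j : Fin N) → G.A j) → ℝ)
    (hW : ∀ a z, W (Function.update a i z) = W a)
    (hle : ∀ t, (∑ a, if G.u (Function.update a i x) i - G.u (Function.update a i y) i + W a ≤ t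
        then weight G p a else 0) ≤ ∑ a, if W a ≤ t then weight G p a else 0)
    (hlt : ∃ t, (∑ a, if G.u (Function.update a i x) i - G.u (Function.update a i y) i + W a ≤ t
        then weight G p a else 0) < ∑ a, if W a ≤ t then weight G p a else 0) :
    p i y ≤ p i x := by
  classical
  set w : ((j : Fin N) → G.A j) → ℝ := fun a => W a - G.u (Function.update a i y) i with hw
  have hwi : ∀ a z, w (Function.update a i z) = w a := by
    intro a z
    simp only [hw, hW, Function.update_idem]
  set u' : ((j : Fin N) → G.A j) → Fin N → ℝ :=
    fun a k => G.u a k + if k = i then w a else 0 with hu'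
  have hmem : p ∈ S { G with u := u' } := by
    have : S G = S { G with u := u' } := by
      refine hSI G u' fun k => ?_
      by_cases hk : k = i
      · subst hk
        exact ⟨w, hwi, fun a => by simp [hu']⟩
      · exact ⟨fun _ => 0, fun _ _ => rfl, fun a => by simp [hu', hk]⟩
    exact this ▸ hp
  have hmix : IsMixed G p := (hS G).2 p hp
  have hc := fun z t => cdfOf_payMass (G := { G with u := u' }) (p := p) hmix i z t
  have hx : ∀ a, u' (Function.update a i x) i =
      G.u (Function.update a i x) i - G.u (Function.update a i y) i + W a := by
    intro a
    simp only [hu', if_true, hwi]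
    simp only [hw]
    ring
  have hy : ∀ a, u' (Function.update a i y) i = W a := by
    intro a
    simp only [hu', if_true, hwi]
    simp only [hw]
    ring
  have hcx : ∀ t, cdfOf (payMass { G with u := u' } p i x) t = ∑ a,
      if G.u (Function.update a i x) i - G.u (Function.update a i y) i + W a ≤ t
        then weight G p a else 0 := by
    intro t
    refine (hc x t).trans (Finset.sum_congr rfl fun a _ => ?_)
    rw [← hx]
    rfl
  have hcy : ∀ t, cdfOf (payMass { G with u := u' } p i y) t = ∑ a,
      if W a ≤ t then weight G p a else 0 := by
    intro t
    refine (hc y t).trans (Finset.sum_congr rfl fun a _ => ?_)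
    rw [← hy]
    rfl
  refine hDM { G with u := u' } p hmem i x y ⟨fun t => ?_, fun heq => ?_⟩
  · rw [hcx, hcy]
    exact hle t
  · obtain ⟨t, ht⟩ := hlt
    rw [← hcx, ← hcy, heq] at ht
    exact lt_irrefl _ ht

/-- Bracketing makes the play of a player with no sure action arbitrarily diffuse. -/
lemma exists_diffuse {S : SolCon N} (hS : IsSolutionConcept S) (hBr : Bracketing S)
    {G : Game N} {p : Profile G} (hp : p ∈ S G) (j : Fin N) (hj : ∀ c, p j c < 1)
    {ε : ℝ} (hε : 0 < ε) : ∃ (H : Game N) (q : Profile H), q ∈ S H ∧ ∀ c, q j c ≤ ε := by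
  obtain ⟨c₀, hc₀⟩ := Finite.exists_max (p j)
  have h0 : ∀ c, 0 ≤ p j c := ((hS G).2 p hp j).1
  have key : ∀ n : ℕ, ∃ (H : Game N) (q : Profile H), q ∈ S H ∧ ∀ c, q j c ≤ p j c₀ ^ (n + 1) := by
    intro n
    induction n with
    | zero => exact ⟨G, p, hp, by simpa using hc₀⟩
    | succ n ih =>
      obtain ⟨H, q, hq, hle⟩ := ih
      refine ⟨H.comp G, prodProfile q p, hBr H G q p hq hp, fun c => ?_⟩
      rw [pow_succ]
      exact mul_le_mul (hle c.1) (hc₀ c.2) (h0 _) (pow_nonneg (h0 _) _)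
  obtain ⟨n, hn⟩ := exists_pow_lt_of_lt_one hε (hj c₀)
  obtain ⟨H, q, hq, hle⟩ := key n
  refine ⟨H, q, hq, fun c => (hle c).trans (le_trans ?_ hn.le)⟩
  exact pow_le_pow_of_le_one (h0 _) (hj c₀).le (Nat.le_succ n)

lemma sum_weight_comp {G H : Game N} (p : Profile G) (q : Profile H)
    (f : ((j : Fin N) → G.A j) → ((j : Fin N) → H.A j) → ℝ) :
    ∑ c, weight (G.comp H) (prodProfile p q) c * f (fun j => (c j).1) (fun j => (c j).2) =
      ∑ a, weight G p a * ∑ b, weight H q b * f a b := by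
  classical
  let e : (((j : Fin N) → G.A j) × ((j : Fin N) → H.A j)) ≃ ((j : Fin N) → (G.comp H).A j) :=
    { toFun := fun ab j => (ab.1 j, ab.2 j)
      invFun := fun c => (fun j => (c j).1, fun j => (c j).2)
      left_inv := fun _ => rfl
      right_inv := fun _ => rfl }
  rw [← e.sum_comp, Fintype.sum_prod_type]
  refine Finset.sum_congr rfl fun a _ => ?_
  rw [Finset.mul_sum]
  refine Finset.sum_congr rfl fun b _ => ?_
  rw [← mul_assoc]
  congr 1
  exact Finset.prod_mul_distrib

end Games

/-- bracketing + strategic invariance + distribution-monotonicity +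
anonymity imply expectation-monotonicity. -/
theorem stmt8 {N : ℕ} (hN : 2 ≤ N) (S : SolCon N) (hS : IsSolutionConcept S)
    (hBr : Bracketing S) (hSI : StratInvariant S)
    (hDM : DistributionMonotone S) (hAn : Anonymity S) :
    ExpectationMonotone S := by
  classical
  intro G p hp i x y hxy
  have hmix := (hS G).2 p hp
  set Z : ((j : Fin N) → G.A j) → ℝ :=
    fun a => G.u (Function.update a i x) i - G.u (Function.update a i y) i with hZdef
  have hZi : ∀ a b : (j : Fin N) → G.A j, (∀ j, j ≠ i → a j = b j) → Z a = Z b := by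
    intro a b hab
    have : ∀ z, Function.update a i z = Function.update b i z := by
      intro z
      funext j
      rcases eq_or_ne j i with rfl | hj
      · simp
      · simp [hj, hab j hj]
    simp only [hZdef, this]
  have hZ : 0 < ∑ a, weight G p a * Z a := by
    have hx := sum_weight_update_delta hmix i x fun a => G.u a i
    have hy := sum_weight_update_delta hmix i y fun a => G.u a i
    simp only [expPay] at hxy
    simp only [hZdef, mul_sub, Finset.sum_sub_distrib]
    rw [← hx, ← hy]
    linarith
  by_cases hdiff : ∃ j, j ≠ i ∧ ∀ c, p j c < 1
  · obtain ⟨j, hji, hj⟩ := hdiff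
    obtain ⟨ε, hε, hnoise⟩ := exists_correlated_noise (weight G p) (weight_nonneg hmix)
      (sum_weight_eq_one hmix) Z hZ
    obtain ⟨H, q, hq, hqε⟩ := exists_diffuse hS hBr hp j hj hε
    have hqmix := (hS H).2 q hq
    obtain ⟨W, hle, hlt⟩ := hnoise (q j) (hqmix j).1 (hqmix j).2 hqε
    obtain ⟨d, hd⟩ : ∃ d, 0 < q i d := by
      by_contra! h
      have := Finset.sum_nonpos fun d (_ : d ∈ Finset.univ) => h d
      linarith [(hqmix i).2]
    have hsum : ∀ (f : ℝ → H.A j → ℝ) (t : ℝ),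
        (∑ c, if f (Z fun k => (c k).1) (c j).2 ≤ t
          then weight (G.comp H) (prodProfile p q) c else 0) =
        ∑ a, weight G p a * ∑ k, if f (Z a) k ≤ t then q j k else 0 := by
      intro f t
      have h := sum_weight_comp p q fun a b => if f (Z a) (b j) ≤ t then 1 else 0
      have h' : ∀ a, (∑ b, weight H q b * if f (Z a) (b j) ≤ t then 1 else 0) =
          ∑ k, q j k * if f (Z a) k ≤ t then 1 else 0 := fun a =>
        sum_weight_mul_apply hqmix j fun k => if f (Z a) k ≤ t then 1 else 0
      simp only [h'] at h
      simp only [mul_ite, mul_one, mul_zero] at h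
      exact h
    have hdiffZ : ∀ c : (k : Fin N) → (G.comp H).A k,
        (G.comp H).u (Function.update c i (x, d)) i - (G.comp H).u (Function.update c i (y, d)) i =
          Z fun k => (c k).1 := by
      intro c
      have h1 : ∀ z : G.A i, (fun k => (Function.update c i (z, d) k).1) =
          Function.update (fun k => (c k).1) i z := fun z => funext fun k =>
        Function.apply_update (fun k (ab : G.A k × H.A k) => ab.1) c i (z, d) k
      have h2 : ∀ z : G.A i, (fun k => (Function.update c i (z, d) k).2) =
          Function.update (fun k => (c k).2) i d := fun z => funext fun k =>
        Function.apply_update (fun k (ab : G.A k × H.A k) => ab.2) c i (z, d) k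
      simp only [Game.comp, hZdef]
      erw [h1, h1, h2, h2]
      ring
    have := le_of_noise hS hSI hDM (hBr G H p q hp hq) i (x, d) (y, d)
      (fun c => W (Z fun k => (c k).1) (c j).2) ?_ ?_ ?_
    · exact le_of_mul_le_mul_right this hd
    · intro c z
      simp only [Function.update_of_ne hji]
      congr 1
      exact hZi _ _ fun k hk => by rw [Function.update_of_ne hk]
    · intro t
      simp only [hdiffZ]
      rw [hsum fun z k => z + W z k, hsum W]
      exact hle t
    · obtain ⟨t, ht⟩ := hlt
      refine ⟨t, ?_⟩
      simp only [hdiffZ]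
      rw [hsum fun z k => z + W z k, hsum W]
      exact ht
  · push Not at hdiff
    have hc : ∀ j, ∃ c, j ≠ i → 1 ≤ p j c := by
      intro j
      by_cases hj : j = i
      · exact ⟨Classical.arbitrary _, fun h => absurd hj h⟩
      · obtain ⟨c, hc⟩ := hdiff j hj
        exact ⟨c, fun _ => hc⟩
    choose c hc using hc
    have hsupp : ∀ a, weight G p a ≠ 0 → Z a = Z c := by
      intro a ha
      refine hZi a c fun j hj => ?_
      by_contra hne
      apply ha
      refine Finset.prod_eq_zero (Finset.mem_univ j) ?_
      have hsum := Finset.add_le_sum (fun k _ => (hmix j).1 k) (Finset.mem_univ (a j))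
        (Finset.mem_univ (c j)) hne
      linarith [(hmix j).2, (hmix j).1 (a j), hc j hj]
    have hZc : 0 < Z c := by
      have : ∑ a, weight G p a * Z a = ∑ a, weight G p a * Z c := by
        refine Finset.sum_congr rfl fun a _ => ?_
        by_cases ha : weight G p a = 0
        · simp [ha]
        · rw [hsupp a ha]
      rwa [this, ← Finset.sum_mul, sum_weight_eq_one hmix, one_mul] at hZ
    have hcdf : ∀ t, (∑ a, if Z a + 0 ≤ t then weight G p a else 0) =
        if Z c ≤ t then 1 else 0 := by
      intro t
      have : ∀ a, (if Z a + 0 ≤ t then weight G p a else 0) =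
          if Z c ≤ t then weight G p a else 0 := by
        intro a
        by_cases ha : weight G p a = 0
        · simp [ha]
        · rw [hsupp a ha, add_zero]
      simp only [this]
      split_ifs
      · exact sum_weight_eq_one hmix
      · simp
    have hcdf0 : ∀ t : ℝ, (∑ a, if (0 : ℝ) ≤ t then weight G p a else 0) =
        if 0 ≤ t then 1 else 0 := by
      intro t
      split_ifs
      · exact sum_weight_eq_one hmix
      · simp
    refine le_of_noise hS hSI hDM hp i x y (fun _ => 0) (fun _ _ => rfl) (fun t => ?_) ⟨0, ?_⟩
    · rw [hcdf0]
      refine (hcdf t).le.trans ?_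
      split_ifs with h1 h2
      · exact le_rfl
      · exact absurd (hZc.le.trans h1) h2
      · exact zero_le_one
      · exact le_rfl
    · rw [hcdf0]
      refine (hcdf 0).trans_lt ?_
      rw [if_neg (not_le.2 hZc), if_pos le_rfl]
      exact zero_lt_one

end Paper
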